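/- For every positive integer x, the ribbon Schur Q-function 𝔯_{(4x)2} indexed by the two-part composition (4x, 2) is irreducible in ℚ[q₁, q₃, q₅, …], while 𝔯_{α⊙α^t} = 𝔯_α²/2 is reducible for every composition α; hence among even-size ribbons there are infinitely many irreducible and infinitely many reducible ribbon Schur Q-functions. -/

import Mathlib

/-- The polynomial `q_n` (with `q_0 = 1`) in `ℚ[q₁, q₂, q₃, …]`. -/
noncomputable def QPoly (n : ℕ) : MvPolynomial ℕ ℚ := if n = 0 then 1 else MvPolynomial.X n

/-- The even Euler forms `χ_{2m} = ∑_{r+s=2m} (-1)^r q_r q_s`, `m ≥ 1`. -/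
def eulerSet : Set (MvPolynomial ℕ ℚ) :=
  {p | ∃ m : ℕ, 1 ≤ m ∧ p = ∑ r ∈ Finset.range (2*m + 1), (-1) ^ r * QPoly r * QPoly (2*m - r)}

/-- `Ω ⊗ ℚ = ℚ[q₁, q₂, q₃, …]/(even Euler relations) ≅ ℚ[q₁, q₃, q₅, …]`. -/
abbrev OmegaQ : Type := MvPolynomial ℕ ℚ ⧸ Ideal.span eulerSet

/-- The generators `q_n` of `Ω` (with `q 0 = 1`). -/
noncomputable def q (n : ℕ) : OmegaQ := Ideal.Quotient.mk (Ideal.span eulerSet) (QPoly n)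

/-- A composition: a nonempty list of positive integers. -/
def IsComposition (α : List ℕ) : Prop := α ≠ [] ∧ ∀ a ∈ α, 0 < a

/-- `α ⊙ β`: add the last part of `α` to the first part of `β`. -/
def compNcat (α β : List ℕ) : List ℕ :=
  match α.reverse with
  | [] => β
  | a :: as =>
    match β with
    | [] => α
    | b :: bs => as.reverse ++ (a + b) :: bs

/-- The list of all coarsenings of a composition (obtained by adding adjacent parts). -/
def coarsenings : List ℕ → List (List ℕ)
  | [] => [[]]
  | [a] => [[a]]
  | a :: b :: t => ((coarsenings (b :: t)).map (a :: ·)) ++ coarsenings ((a + b) :: t)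
  termination_by α => α.length

/-- `q_{λ(β)} = q_{β₁} ⋯ q_{β_m}`. -/
noncomputable def qProd (β : List ℕ) : OmegaQ := (β.map q).prod

/-- The ribbon Schur Q-function `𝔯_α = (-1)^{ℓ(α)} ∑_{β ⪰ α} (-1)^{ℓ(β)} q_{λ(β)}`. -/
noncomputable def ribbonQ (α : List ℕ) : OmegaQ :=
  (-1) ^ α.length * ((coarsenings α).map (fun β => (-1 : OmegaQ) ^ β.length * qProd β)).sum

/-- The stars (joining operations) of the ribbon of the composition `α`. -/
def starsOf : List ℕ → List Bool
  | [] => []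
  | [a] => List.replicate (a - 1) true
  | a :: b :: t => List.replicate (a - 1) true ++ false :: starsOf (b :: t)

/-- Reconstruct a composition from its list of stars. -/
def fromStars : List Bool → List ℕ
  | [] => [1]
  | true :: rest =>
    match fromStars rest with
    | [] => [1]
    | a :: t => (a + 1) :: t
  | false :: rest => 1 :: fromStars rest

/-- The transpose (conjugate) of a ribbon, as a composition. -/
def compTranspose (α : List ℕ) : List ℕ :=
  fromStars (((starsOf α).reverse).map (fun b => !b))

section Part1

/-- The sequence determined by its odd terms through the Euler relations. -/
noncomputable def EE {A : Type} [CommRing A] [Algebra ℚ A] (v : ℕ → A) (n : ℕ) : A :=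
  if n = 0 then 1 else if n % 2 = 1 then v n else
    algebraMap ℚ A (-1/2) * ∑ i : Fin (n - 1), (-1) ^ (i.1 + 1) * EE v (i.1 + 1) * EE v (n - (i.1 + 1))
termination_by n
decreasing_by
  all_goals
    have := i.isLt
    omega

variable {A : Type} [CommRing A] [Algebra ℚ A] {A' : Type} [CommRing A'] [Algebra ℚ A']

theorem EE_zero (v : ℕ → A) : EE v 0 = 1 := by rw [EE]; simp

theorem EE_odd (v : ℕ → A) (n : ℕ) (h : n % 2 = 1) : EE v n = v n := by
  rw [EE, if_neg (by omega), if_pos h]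

theorem EE_even (v : ℕ → A) (n : ℕ) (h0 : n ≠ 0) (h : n % 2 = 0) : EE v n =
    algebraMap ℚ A (-1/2) * ∑ i ∈ Finset.range (n - 1),
      (-1) ^ (i + 1) * EE v (i + 1) * EE v (n - (i + 1)) := by
  rw [EE, if_neg h0, if_neg (by omega), Finset.sum_range]

theorem EE_unique (v w : ℕ → A) (h0 : w 0 = 1) (hodd : ∀ n, n % 2 = 1 → w n = v n)
    (hev : ∀ n, n ≠ 0 → n % 2 = 0 → w n = algebraMap ℚ A (-1/2) * ∑ i ∈ Finset.range (n - 1),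
      (-1) ^ (i + 1) * w (i + 1) * w (n - (i + 1))) (n : ℕ) : w n = EE v n := by
  induction n using Nat.strong_induction_on with
  | _ n ih =>
    by_cases hn : n = 0
    · subst hn; rw [h0, EE_zero]
    rcases Nat.mod_two_eq_zero_or_one n with h | h
    · rw [EE_even v n hn h, hev n hn h]
      congr 1
      refine Finset.sum_congr rfl fun i hi => ?_
      have := Finset.mem_range.1 hi
      rw [ih (i+1) (by omega), ih (n - (i+1)) (by omega)]
    · rw [EE_odd v n h, hodd n h]

theorem EE_map (φ : A →ₐ[ℚ] A') (v : ℕ → A) (w : ℕ → A') (h : ∀ n, n % 2 = 1 → φ (v n) = w n)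
    (n : ℕ) : φ (EE v n) = EE w n := by
  refine EE_unique w (fun n => φ (EE v n)) ?_ ?_ ?_ n
  · simp [EE_zero]
  · intro n hn
    simp only [EE_odd v n hn]; exact h n hn
  · intro n h0 hn
    simp only [EE_even v n h0 hn]
    simp

theorem euler_iff (w : ℕ → A) (h0 : w 0 = 1) (m : ℕ) (hm : 1 ≤ m) :
    ∑ r ∈ Finset.range (2*m+1), (-1)^r * w r * w (2*m - r) = 0 ↔
    w (2*m) = algebraMap ℚ A (-1/2) * ∑ i ∈ Finset.range (2*m - 1),
      (-1) ^ (i + 1) * w (i + 1) * w (2*m - (i + 1)) := by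
  obtain ⟨k, rfl⟩ : ∃ k, m = k + 1 := ⟨m - 1, by omega⟩
  have e : 2 * (k+1) - 1 = 2*k+1 := by omega
  rw [Finset.sum_range_succ, show 2 * (k+1) = (2*k+1)+1 by ring, Finset.sum_range_succ']
  simp only [Nat.add_sub_cancel, Nat.sub_self, h0, Nat.sub_zero]
  set S := ∑ i ∈ Finset.range (2*k+1), (-1 : A) ^ (i + 1) * w (i + 1) * w (2*k+1+1 - (i + 1))
  have h2 : algebraMap ℚ A (-1/2) * 2 = -1 := by
    rw [← map_ofNat (algebraMap ℚ A) 2, ← map_mul]; norm_num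
  have hs : (-1 : A)^(2*k+1+1) = 1 := by
    rw [show 2*k+1+1 = 2*(k+1) by ring, pow_mul]; simp
  rw [hs]
  constructor
  · intro h
    have : algebraMap ℚ A (-1/2) * (S + 2 * w (2*k+1+1)) = 0 := by
      rw [show S + 2 * w (2*k+1+1) = 0 by linear_combination h, mul_zero]
    linear_combination (-1 : A) * this - (- w (2*k+1+1)) * h2
  · intro h
    linear_combination 2 * h + S * h2

theorem q_eq_EE (n : ℕ) : q n = EE q n := by
  have q0 : q 0 = 1 := by simp [q, QPoly]
  refine EE_unique q q q0 (fun _ _ => rfl) ?_ n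
  intro n h0 hn
  obtain ⟨m, rfl⟩ : ∃ m, n = 2 * m := ⟨n / 2, by omega⟩
  refine (euler_iff q q0 m (by omega)).1 ?_
  have : Ideal.Quotient.mk (Ideal.span eulerSet)
      (∑ r ∈ Finset.range (2*m + 1), (-1) ^ r * QPoly r * QPoly (2*m - r)) = 0 :=
    Ideal.Quotient.eq_zero_iff_mem.2 (Ideal.subset_span ⟨m, by omega, rfl⟩)
  rw [map_sum] at this
  simpa [q] using this

/-- Images of the variables. -/
noncomputable def pre (v : ℕ → A) (n : ℕ) : A := if n = 0 then v 0 else EE v n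

/-- The hom out of `OmegaQ` determined by the odd values. -/
noncomputable def Phi (v : ℕ → A) : OmegaQ →ₐ[ℚ] A :=
  Ideal.Quotient.liftₐ (Ideal.span eulerSet) (MvPolynomial.aeval (pre v)) (by
    have : Ideal.span eulerSet ≤ RingHom.ker (MvPolynomial.aeval (R := ℚ) (pre v)) := by
      rw [Ideal.span_le]
      rintro p ⟨m, hm, rfl⟩
      have hQ : ∀ n, MvPolynomial.aeval (R := ℚ) (pre v) (QPoly n) = EE v n := by
        intro n
        by_cases h : n = 0
        · simp [QPoly, h, EE_zero]
        · simp [QPoly, h, pre]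
      have := (euler_iff (EE v) (EE_zero v) m hm).2 (EE_even v _ (by omega) (by omega))
      simpa [RingHom.mem_ker, hQ] using this
    exact fun a ha => this ha)

theorem Phi_mk (v : ℕ → A) (p) : Phi v (Ideal.Quotient.mk _ p) = MvPolynomial.aeval (pre v) p := rfl

theorem Phi_q (v : ℕ → A) (n : ℕ) : Phi v (q n) = EE v n := by
  rw [q, Phi_mk]
  by_cases h : n = 0
  · simp [QPoly, h, EE_zero]
  · simp [QPoly, h, pre]

theorem omega_ext (f g : OmegaQ →ₐ[ℚ] A)
    (h0 : f (Ideal.Quotient.mk _ (MvPolynomial.X 0)) = g (Ideal.Quotient.mk _ (MvPolynomial.X 0)))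
    (h : ∀ n, n % 2 = 1 → f (q n) = g (q n)) : f = g := by
  apply Ideal.Quotient.algHom_ext
  apply MvPolynomial.algHom_ext
  intro n
  by_cases hn : n = 0
  · subst hn; exact h0
  · have e : Ideal.Quotient.mk (Ideal.span eulerSet) (MvPolynomial.X n) = q n := by
      simp [q, QPoly, hn]
    change f (Ideal.Quotient.mk _ _) = g (Ideal.Quotient.mk _ _)
    rw [e, q_eq_EE, EE_map f q (fun n => g (q n)) h, EE_map g q (fun n => g (q n)) (fun _ _ => rfl)]

/-- Index set of free generators. -/
abbrev Sg : Type := {n : ℕ // n = 0 ∨ n % 2 = 1}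

/-- Free generators. -/
noncomputable def vv (n : ℕ) : MvPolynomial Sg ℚ :=
  if h : n = 0 ∨ n % 2 = 1 then MvPolynomial.X ⟨n, h⟩ else 0

/-- `OmegaQ` is a polynomial ring. -/
noncomputable def omegaEquiv : OmegaQ ≃ₐ[ℚ] MvPolynomial Sg ℚ :=
  AlgEquiv.ofAlgHom (Phi vv)
    (MvPolynomial.aeval (fun i : Sg => Ideal.Quotient.mk (Ideal.span eulerSet) (MvPolynomial.X i.1)))
    (by
      apply MvPolynomial.algHom_ext
      rintro ⟨n, hn⟩
      simp only [AlgHom.comp_apply, MvPolynomial.aeval_X, Phi_mk, AlgHom.id_apply]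
      by_cases h : n = 0
      · subst h; simp [pre, vv]
      · have h1 : n % 2 = 1 := by omega
        simp [pre, vv, h, EE_odd _ _ h1, h1])
    (by
      apply omega_ext
      · simp [Phi_mk, pre, vv]
      · intro n h1
        have hn : n ≠ 0 := by omega
        simp only [AlgHom.comp_apply, Phi_q, EE_odd _ _ h1, vv, h1, AlgHom.id_apply]
        simp [q, QPoly, hn])

theorem omegaEquiv_q (n : ℕ) : omegaEquiv (q n) = EE vv n := Phi_q vv n

theorem ribbon_two (a b : ℕ) : ribbonQ [a, b] = q a * q b - q (a + b) := by
  simp [ribbonQ, coarsenings, qProd]; ring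

theorem EE_ind (x : ℕ) (hx : 1 ≤ x) (n : ℕ) (h0 : 0 < n) (h1 : n < 4*x+2) (h2 : n ≠ 2*x+1) :
    EE (fun k => if k = 2*x+1 then (1:ℚ) else 0) n = 0 := by
  induction n using Nat.strong_induction_on with
  | _ n ih =>
    rcases Nat.mod_two_eq_zero_or_one n with h | h
    · rw [EE_even _ n (by omega) h, Finset.sum_eq_zero, mul_zero]
      intro i hi
      have := Finset.mem_range.1 hi
      by_cases hi2 : i + 1 = 2*x+1
      · rw [ih (n - (i+1)) (by omega) (by omega) (by omega) (by omega), mul_zero]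
      · rw [ih (i+1) (by omega) (by omega) (by omega) (by omega), mul_zero, zero_mul]
    · rw [EE_odd _ n h]; simp [h2]

theorem EE_ind_top (x : ℕ) (hx : 1 ≤ x) :
    EE (fun k => if k = 2*x+1 then (1:ℚ) else 0) (4*x+2) = 1/2 := by
  rw [EE_even _ _ (by omega) (by omega), Finset.sum_eq_single (2*x)]
  · rw [show 4*x+2 - (2*x+1) = 2*x+1 by omega, EE_odd _ _ (by omega)]
    simp [pow_succ, pow_mul]; norm_num
  · intro i hi hne
    have := Finset.mem_range.1 hi
    rw [EE_ind x hx (i+1) (by omega) (by omega) (by omega), mul_zero, zero_mul]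
  · intro h; exfalso; apply h; simp; omega

theorem EE_agree (v w : ℕ → A) (N : ℕ) (h : ∀ n < N, v n = w n) (n : ℕ) (hn : n < N) :
    EE v n = EE w n := by
  induction n using Nat.strong_induction_on with
  | _ n ih =>
    by_cases h0 : n = 0
    · subst h0; simp [EE_zero]
    rcases Nat.mod_two_eq_zero_or_one n with h1 | h1
    · rw [EE_even v n h0 h1, EE_even w n h0 h1]
      congr 1
      refine Finset.sum_congr rfl fun i hi => ?_
      have := Finset.mem_range.1 hi
      rw [ih (i+1) (by omega) (by omega), ih (n - (i+1)) (by omega) (by omega)]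
    · rw [EE_odd v n h1, EE_odd w n h1, h n hn]

theorem EE_top (v w : ℕ → A) (x : ℕ) (hx : 1 ≤ x) (h : ∀ n < 4*x+1, v n = w n)
    (hw : w (4*x+1) = 0) :
    EE v (4*x+2) = v 1 * v (4*x+1) + EE w (4*x+2) := by
  have hA := EE_agree v w (4*x+1) h
  have h2 : algebraMap ℚ A (-1/2) * 2 = -1 := by
    rw [← map_ofNat (algebraMap ℚ A) 2, ← map_mul]; norm_num
  rw [EE_even v _ (by omega) (by omega), EE_even w _ (by omega) (by omega)]
  rw [show 4*x+2-1 = 4*x+1 by omega, Finset.sum_range_succ, Finset.sum_range_succ]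
  rw [show 4*x = (4*x-1)+1 by omega, Finset.sum_range_succ', Finset.sum_range_succ']
  rw [show 4*x-1+1 = 4*x by omega]
  have : ∑ i ∈ Finset.range (4*x-1), (-1 : A) ^ (i + 1 + 1) * EE v (i + 1 + 1) * EE v (4*x+2 - (i + 1 + 1))
    = ∑ i ∈ Finset.range (4*x-1), (-1 : A) ^ (i + 1 + 1) * EE w (i + 1 + 1) * EE w (4*x+2 - (i + 1 + 1)) := by
    refine Finset.sum_congr rfl fun i hi => ?_
    have := Finset.mem_range.1 hi
    rw [hA (i+1+1) (by omega), hA (4*x+2 - (i+1+1)) (by omega)]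
  rw [this, show 4*x+2-(0+1) = 4*x+1 by omega, show 4*x+2-(4*x+1) = 1 by omega]
  simp only [zero_add]
  rw [EE_odd v (4*x+1) (by omega), EE_odd w (4*x+1) (by omega), EE_odd v 1 (by omega), hw]
  have hs : (-1 : A)^(4*x+1) = -1 := by
    rw [pow_succ, show 4*x = 2*(2*x) by ring, pow_mul]; simp
  rw [hs]
  linear_combination (-(v 1 * v (4*x+1))) * h2

theorem EE_mem (S : Subalgebra ℚ A) (v : ℕ → A) (h : ∀ n, v n ∈ S) (n : ℕ) : EE v n ∈ S := by
  rw [← EE_map S.val (fun n => ⟨v n, h n⟩) v (fun _ _ => rfl) n]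
  exact Subtype.property _

theorem irred_part (x : ℕ) (hx : 1 ≤ x) : Irreducible (ribbonQ [4*x, 2]) := by
  rw [← MulEquiv.irreducible_iff (omegaEquiv : OmegaQ ≃ₐ[ℚ] _), ribbon_two, map_sub, map_mul]
  simp only [omegaEquiv_q]
  set w : ℕ → MvPolynomial Sg ℚ := fun n => if n = 4*x+1 then 0 else vv n with hw
  have hag : ∀ n < 4*x+1, vv n = w n := by
    intro n hn; simp only [hw]; rw [if_neg (by omega)]
  have hw0 : w (4*x+1) = 0 := by simp [hw]
  rw [EE_top vv w x hx hag hw0, EE_agree vv w _ hag (4*x) (by omega),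
    EE_agree vv w _ hag 2 (by omega)]
  set b := EE w (4*x) * EE w 2 - EE w (4*x+2) with hb
  have v1 : vv 1 = MvPolynomial.X (⟨1, by simp⟩ : Sg) := by simp [vv]
  have vN : vv (4*x+1) = MvPolynomial.X (⟨4*x+1, by omega⟩ : Sg) := by
    rw [vv, dif_pos]
  rw [show EE w (4*x) * EE w 2 - (vv 1 * vv (4*x+1) + EE w (4*x+2)) =
    (- vv 1) * vv (4*x+1) + b by rw [hb]; ring, vN]
  have hS : ∀ p ∈ MvPolynomial.supported ℚ ({(⟨4*x+1, by omega⟩ : Sg)}ᶜ : Set Sg),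
      (⟨4*x+1, by omega⟩ : Sg) ∉ p.vars := by
    intro p hp hmem
    have := MvPolynomial.mem_supported.1 hp hmem
    simp at this
  have hwS : ∀ n, w n ∈ MvPolynomial.supported ℚ ({(⟨4*x+1, by omega⟩ : Sg)}ᶜ : Set Sg) := by
    intro n
    simp only [hw, vv]
    split_ifs with h1 h2
    · exact zero_mem _
    · rw [MvPolynomial.X_mem_supported]
      simp [h1]
    · exact zero_mem _
  have hE := EE_mem _ w hwS
  apply MvPolynomial.irreducible_mul_X_add
  · rw [v1]; simp
  · apply hS
    have := hwS 1
    rw [← hag 1 (by omega)] at this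
    exact neg_mem this
  · apply hS
    exact sub_mem (mul_mem (hE _) (hE _)) (hE _)
  · have hirr : Irreducible (-vv 1) := by
      rw [v1]
      exact (Associated.refl _).neg_right.irreducible (MvPolynomial.X_prime).irreducible
    rw [hirr.isRelPrime_iff_not_dvd]
    intro hdvd
    let u : ℕ → ℚ := fun k => if k = 2*x+1 then 1 else 0
    let φ : MvPolynomial Sg ℚ →ₐ[ℚ] ℚ := MvPolynomial.aeval (fun i : Sg => u i.1)
    have h1 := map_dvd φ hdvd
    have hφ : ∀ n, n % 2 = 1 → φ (w n) = u n := by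
      intro n hn
      by_cases h1 : n = 4*x+1
      · have h2 : n ≠ 2*x+1 := by omega
        simp only [hw, u, if_pos h1, if_neg h2, map_zero]
      · simp only [hw, if_neg h1, vv, dif_pos (show n = 0 ∨ n % 2 = 1 from Or.inr hn), φ,
          MvPolynomial.aeval_X]
    have h2 : φ (-vv 1) = 0 := by
      rw [hag 1 (by omega), map_neg, hφ 1 rfl]
      simp [u]; omega
    have h3 : φ b = -(1/2) := by
      rw [hb, map_sub, map_mul, EE_map φ w u hφ, EE_map φ w u hφ, EE_map φ w u hφ,
        EE_ind x hx 2 (by omega) (by omega) (by omega), EE_ind_top x hx]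
      simp
    rw [h2, h3] at h1
    have := zero_dvd_iff.1 h1
    norm_num at this

end Part1

section Part2

theorem q_zero : q 0 = 1 := by simp [q, QPoly]

theorem ribbon_cons (a b : ℕ) (t : List ℕ) :
    ribbonQ (a :: b :: t) = q a * ribbonQ (b :: t) - ribbonQ ((a + b) :: t) := by
  have h : ∀ L : List (List ℕ),
      ((L.map (a :: ·)).map (fun β => (-1 : OmegaQ) ^ β.length * qProd β)).sum =
      - q a * (L.map (fun β => (-1 : OmegaQ) ^ β.length * qProd β)).sum := by
    intro L
    induction L with
    | nil => simp
    | cons l L ih =>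
      rw [List.map_cons, List.map_cons, List.sum_cons, ih, List.map_cons, List.sum_cons]
      simp only [List.length_cons, qProd, List.map_cons, List.prod_cons]
      ring
  rw [ribbonQ, ribbonQ, ribbonQ, coarsenings, List.map_append, List.sum_append, h]
  simp only [List.length_cons]
  ring

theorem ribbon_single (a : ℕ) : ribbonQ [a] = q a := by
  simp [ribbonQ, coarsenings, qProd]
  ring

theorem ribbon_nil : ribbonQ [] = 1 := by
  simp [ribbonQ, coarsenings, qProd]

theorem ribbon_mul (n : ℕ) : ∀ (l : List ℕ), l.length = n → ∀ (a b : ℕ) (u : List ℕ),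
    ribbonQ (l ++ [a]) * ribbonQ (b :: u) =
      ribbonQ (l ++ a :: b :: u) + ribbonQ (l ++ (a + b) :: u) := by
  induction n with
  | zero =>
    intro l hl a b u
    rw [List.length_eq_zero_iff.1 hl]
    simp only [List.nil_append, ribbon_single, ribbon_cons a b u]
    ring
  | succ n ih =>
    intro l hl a b u
    match l, hl with
    | [c], hl =>
      have h0 : n = 0 := by simpa using hl.symm
      subst h0
      have h1 := ih [] rfl a b u
      have h2 := ih [] rfl (c + a) b u
      simp only [List.nil_append, List.cons_append] at h1 h2 ⊢
      rw [ribbon_cons c a, ribbon_cons c a, ribbon_cons c (a+b), sub_mul, mul_assoc, h1, h2,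
        add_assoc]
      ring
    | c :: d :: l, hl =>
      have h1 := ih (d :: l) (by simpa using hl) a b u
      have h2 := ih ((c + d) :: l) (by simpa using hl) a b u
      simp only [List.cons_append] at h1 h2 ⊢
      rw [ribbon_cons c d, ribbon_cons c d, ribbon_cons c d, sub_mul, mul_assoc, h1, h2]
      ring

theorem sgn_aux {A : Type} [CommRing A] (m i : ℕ) (hi : i < 2*m+1+1) :
    (-1 : A)^(2*m+1-i) = -(-1)^i := by
  rcases Nat.even_or_odd i with h | h
  · rw [h.neg_one_pow, Odd.neg_one_pow (by rw [Nat.odd_iff]; rw [Nat.even_iff] at h; omega)]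
  · rw [h.neg_one_pow, Even.neg_one_pow (by rw [Nat.even_iff]; rw [Nat.odd_iff] at h; omega)]
    simp

theorem euler_all (n : ℕ) (hn : 1 ≤ n) :
    ∑ r ∈ Finset.range (n + 1), (-1) ^ r * q r * q (n - r) = 0 := by
  rcases Nat.even_or_odd' n with ⟨m, rfl | rfl⟩
  · rw [euler_iff q q_zero m (by omega)]
    conv_lhs => rw [q_eq_EE, EE_even q _ (by omega) (by omega)]
    simp only [← q_eq_EE]
  · have h := Finset.sum_range_reflect (fun r => (-1 : OmegaQ) ^ r * q r * q (2*m+1 - r)) (2*m+1+1)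
    have h2 : ∑ j ∈ Finset.range (2*m+1+1), (-1 : OmegaQ) ^ (2*m+1+1-1-j) * q (2*m+1+1-1-j) *
        q (2*m+1 - (2*m+1+1-1-j)) =
        - ∑ r ∈ Finset.range (2*m+1+1), (-1) ^ r * q r * q (2*m+1 - r) := by
      rw [← Finset.sum_neg_distrib]
      refine Finset.sum_congr rfl fun i hi => ?_
      have hi := Finset.mem_range.1 hi
      rw [show 2*m+1+1-1-i = 2*m+1-i by omega, show 2*m+1-(2*m+1-i) = i by omega]
      have : (-1 : OmegaQ)^(2*m+1-i) = -(-1)^i := sgn_aux m i (by omega)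
      rw [this]; ring
    rw [h2] at h
    set S := ∑ r ∈ Finset.range (2*m+1+1), (-1 : OmegaQ) ^ r * q r * q (2*m+1 - r)
    have h3 : algebraMap ℚ OmegaQ (1/2) * 2 = 1 := by
      rw [← map_ofNat (algebraMap ℚ OmegaQ) 2, ← map_mul]; norm_num
    linear_combination (-S) * h3 - algebraMap ℚ OmegaQ (1/2) * h

theorem hook (k : ℕ) : ∀ a, ribbonQ (a :: List.replicate k 1) =
    ∑ i ∈ Finset.range (k + 1), (-1) ^ i * q (a + i) * ribbonQ (List.replicate (k - i) 1) := by
  induction k with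
  | zero => intro a; simp [ribbon_single, ribbon_nil]
  | succ k ih =>
    intro a
    rw [List.replicate_succ, ribbon_cons, ih (a+1), Finset.sum_range_succ' _ (k+1), ← List.replicate_succ,
      sub_eq_add_neg, ← Finset.sum_neg_distrib, add_comm]
    congr 1
    · refine Finset.sum_congr rfl fun i _ => ?_
      rw [show a + 1 + i = a + (i + 1) by ring, show k + 1 - (i+1) = k - i by omega]
      ring
    · simp

theorem ribbon_ones (n : ℕ) : ribbonQ (List.replicate n 1) = q n := by
  induction n using Nat.strong_induction_on with
  | _ n ih =>
    match n, ih with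
    | 0, _ => simp [ribbon_nil, q_zero]
    | k + 1, ih =>
      rw [List.replicate_succ, hook]
      have h := euler_all (k+1) (by omega)
      rw [Finset.sum_range_succ'] at h
      have e : ∑ i ∈ Finset.range (k + 1), (-1) ^ i * q (1 + i) * ribbonQ (List.replicate (k - i) 1)
        = - ∑ i ∈ Finset.range (k + 1), (-1) ^ (i+1) * q (i + 1) * q (k + 1 - (i + 1)) := by
        rw [← Finset.sum_neg_distrib]
        refine Finset.sum_congr rfl fun i _ => ?_
        rw [ih (k - i) (by omega), show k + 1 - (i+1) = k - i by omega, add_comm 1 i]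
        ring
      rw [e]
      simp only [pow_zero, q_zero, Nat.sub_zero, one_mul] at h
      linear_combination -h

theorem fromStars_ex (s : List Bool) : ∃ b u, fromStars s = b :: u := by
  cases s with
  | nil => exact ⟨_, _, rfl⟩
  | cons x s =>
    cases x with
    | false => exact ⟨_, _, rfl⟩
    | true =>
      rw [fromStars]
      split <;> exact ⟨_, _, rfl⟩

theorem fromStars_app (s : List Bool) : ∃ l a, fromStars s = l ++ [a] ∧
    ∀ t b u, fromStars t = b :: u → fromStars (s ++ false :: t) = l ++ a :: b :: u ∧
      fromStars (s ++ true :: t) = l ++ (a + b) :: u := by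
  induction s with
  | nil =>
    refine ⟨[], 1, rfl, fun t b u h => ?_⟩
    simp [fromStars, h, add_comm]
  | cons x s ih =>
    obtain ⟨l, a, h1, h2⟩ := ih
    cases x with
    | false =>
      refine ⟨1 :: l, a, by simp [fromStars, h1], fun t b u h => ?_⟩
      obtain ⟨h3, h4⟩ := h2 t b u h
      simp [fromStars, h3, h4]
    | true =>
      cases l with
      | nil =>
        refine ⟨[], a + 1, by simp [fromStars, h1], fun t b u h => ?_⟩
        obtain ⟨h3, h4⟩ := h2 t b u h
        simp [fromStars, h3, h4]
        ring
      | cons c l =>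
        refine ⟨(c + 1) :: l, a, by simp [fromStars, h1], fun t b u h => ?_⟩
        obtain ⟨h3, h4⟩ := h2 t b u h
        simp [fromStars, h3, h4]

theorem fromStars_ncat (s t : List Bool) :
    compNcat (fromStars s) (fromStars t) = fromStars (s ++ true :: t) := by
  obtain ⟨l, a, h1, h2⟩ := fromStars_app s
  obtain ⟨b, u, h⟩ := fromStars_ex t
  rw [(h2 t b u h).2, h1, h]
  simp [compNcat]

theorem ribR_mul (s t : List Bool) : ribbonQ (fromStars s) * ribbonQ (fromStars t) =
    ribbonQ (fromStars (s ++ false :: t)) + ribbonQ (fromStars (s ++ true :: t)) := by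
  obtain ⟨l, a, h1, h2⟩ := fromStars_app s
  obtain ⟨b, u, h⟩ := fromStars_ex t
  rw [(h2 t b u h).2, (h2 t b u h).1, h1, h]
  exact ribbon_mul _ l rfl a b u

theorem fromStars_true (k : ℕ) : fromStars (List.replicate k true) = [k + 1] := by
  induction k with
  | zero => rfl
  | succ k ih => simp [List.replicate_succ, fromStars, ih]

theorem fromStars_false (k : ℕ) : fromStars (List.replicate k false) = List.replicate (k+1) 1 := by
  induction k with
  | zero => rfl
  | succ k ih => rw [List.replicate_succ, fromStars, ih]; rfl

theorem fromStars_true_app (k : ℕ) (s : List Bool) :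
    fromStars (List.replicate k true ++ false :: s) = (k + 1) :: fromStars s := by
  induction k with
  | zero => rfl
  | succ k ih => simp [List.replicate_succ, fromStars, ih]

theorem fromStars_starsOf : ∀ α : List ℕ, α ≠ [] → (∀ a ∈ α, 0 < a) → fromStars (starsOf α) = α
  | [], h, _ => absurd rfl h
  | [a], _, h => by
    have := h a (by simp)
    rw [starsOf, fromStars_true, Nat.sub_add_cancel this]
  | a :: b :: t, _, h => by
    have := h a (by simp)
    rw [starsOf, fromStars_true_app, Nat.sub_add_cancel this,
      fromStars_starsOf (b :: t) (by simp) (fun c hc => h c (List.mem_cons_of_mem _ hc))]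

/-- Transposition on stars. -/
def dualS (s : List Bool) : List Bool := (s.reverse).map (fun b => !b)

theorem dualS_app (s t : List Bool) (b : Bool) :
    dualS (s ++ b :: t) = dualS t ++ (!b) :: dualS s := by
  simp [dualS]

theorem dualS_dualS (s : List Bool) : dualS (dualS s) = s := by
  simp [dualS, Function.comp_def]

theorem ribR_dual (n : ℕ) : ∀ s : List Bool, s.count false = n →
    ribbonQ (fromStars (dualS s)) = ribbonQ (fromStars s) := by
  induction n using Nat.strong_induction_on with
  | _ n ih =>
    intro s hs
    by_cases hm : false ∈ s
    · obtain ⟨s1, s2, rfl⟩ := List.append_of_mem hm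
      simp only [List.count_append, List.count_cons_self] at hs
      have e1 := ih _ (by omega) s1 rfl
      have e2 := ih _ (by omega) s2 rfl
      have e3 := ih ((s1 ++ true :: s2).count false)
        (by simp only [List.count_append, List.count_cons]; simp; omega) _ rfl
      have m1 := ribR_mul s1 s2
      have m2 := ribR_mul (dualS s2) (dualS s1)
      rw [dualS_app] at e3 ⊢
      rw [e1, e2] at m2
      simp only [Bool.not_true, Bool.not_false] at e3 ⊢
      linear_combination m1 - m2 - e3
    · have : s = List.replicate s.length true := by
        rw [List.eq_replicate_iff]
        refine ⟨rfl, fun b hb => ?_⟩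
        cases b with
        | true => rfl
        | false => exact absurd hb hm
      rw [this, dualS, List.reverse_replicate, List.map_replicate, Bool.not_true, fromStars_false,
        fromStars_true, ribbon_ones, ribbon_single]

theorem red_part (α : List ℕ) (hα : IsComposition α) :
    2 * ribbonQ (compNcat α (compTranspose α)) = ribbonQ α ^ 2 := by
  have hs := fromStars_starsOf α hα.1 hα.2
  have ht : compTranspose α = fromStars (dualS (starsOf α)) := rfl
  rw [ht]
  generalize starsOf α = s at *
  subst hs
  rw [fromStars_ncat]
  have h1 := ribR_mul s (dualS s)
  have h2 := ribR_dual _ s rfl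
  have h3 := ribR_dual _ (s ++ true :: dualS s) rfl
  rw [dualS_app, dualS_dualS, Bool.not_true] at h3
  rw [h2, h3] at h1
  linear_combination -h1

theorem not_irr (r a : OmegaQ) (h : 2 * r = a ^ 2) : ¬ Irreducible r := by
  intro hr
  have h3 : algebraMap ℚ OmegaQ (1/2) * 2 = 1 := by
    rw [← map_ofNat (algebraMap ℚ OmegaQ) 2, ← map_mul]; norm_num
  have e : r = (algebraMap ℚ OmegaQ (1/2) * a) * a := by
    linear_combination algebraMap ℚ OmegaQ (1/2) * h - r * h3
  have ha : IsUnit a := by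
    rcases hr.isUnit_or_isUnit e with h | h
    · exact isUnit_of_mul_isUnit_right h
    · exact h
  refine hr.not_isUnit ?_
  rw [e]
  exact ((IsUnit.of_mul_eq_one _ h3).mul ha).mul ha

end Part2

/-- `𝔯_{(4x)2}` is irreducible in `Ω ⊗ ℚ ≅ ℚ[q₁, q₃, q₅, …]` for every
`x ≥ 1`, while `𝔯_{α⊙αᵗ} = 𝔯_α²/2` is reducible for every composition `α`; so among
even-size ribbons there are infinitely many irreducible and reducible examples. -/
theorem ribbonQ_irred_and_red :
    (∀ x : ℕ, 1 ≤ x → Irreducible (ribbonQ [4*x, 2])) ∧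
    (∀ α : List ℕ, IsComposition α →
      2 * ribbonQ (compNcat α (compTranspose α)) = ribbonQ α ^ 2 ∧
      ¬ Irreducible (ribbonQ (compNcat α (compTranspose α)))) := by
  exact ⟨irred_part, fun α hα => ⟨red_part α hα, not_irr _ _ (red_part α hα)⟩⟩
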